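/- The set {β(G) : G a finite group} is dense in [0, ∞). -/

import Mathlib

noncomputable def beta (G : Type*) [Group G] : ℝ :=
  (Nat.card (Subgroup G) : ℝ) / (Nat.card G : ℝ)

open Module Filter

/-- Linearly independent `k`-tuples are sorted by the `k`-dimensional subspace they span. -/
theorem card_submodule_finrank_mul {K V : Type*} [Field K] [Finite K] [AddCommGroup V]
    [Module K V] [Finite V] {k : ℕ} (hk : k ≤ finrank K V) :
    Nat.card {W : Submodule K V // finrank K W = k} *
        ∏ i : Fin k, (Nat.card K ^ k - Nat.card K ^ i.val) =
      ∏ i : Fin k, (Nat.card K ^ finrank K V - Nat.card K ^ i.val) := by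
  have := Fintype.ofFinite K
  have := Fintype.ofFinite V
  have := Fintype.ofFinite {W : Submodule K V // finrank K W = k}
  have span_eq (W : Submodule K V) (hW : finrank K W = k) (s : Fin k → W)
      (hs : LinearIndependent K s) :
      Submodule.span K (Set.range fun i ↦ (s i : V)) = W := by
    apply Submodule.eq_of_le_of_finrank_eq
    · rw [Submodule.span_le]
      rintro _ ⟨i, rfl⟩
      exact (s i).2
    · have h := finrank_span_eq_card (hs.map' W.subtype W.ker_subtype)
      rw [Fintype.card_fin] at h
      exact h.trans hW.symm
  let f : (Σ W : {W : Submodule K V // finrank K W = k},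
      {s : Fin k → W.1 // LinearIndependent K s}) → {s : Fin k → V // LinearIndependent K s} :=
    fun x ↦ ⟨fun i ↦ (x.2.1 i : V), x.2.2.map' x.1.1.subtype x.1.1.ker_subtype⟩
  have hf : f.Bijective := by
    constructor
    · rintro ⟨⟨W, hW⟩, ⟨s, hs⟩⟩ ⟨⟨W', hW'⟩, ⟨s', hs'⟩⟩ h
      have h' : (fun i ↦ (s i : V)) = fun i ↦ (s' i : V) := congrArg Subtype.val h
      obtain rfl : W = W' := by rw [← span_eq W hW s hs, h', span_eq W' hW' s' hs']
      obtain rfl : s = s' := by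
        funext i
        exact Subtype.ext (congrFun h' i)
      rfl
    · rintro ⟨s, hs⟩
      refine ⟨⟨⟨Submodule.span K (Set.range s), ?_⟩, ⟨_, linearIndependent_span hs⟩⟩, ?_⟩
      · rw [finrank_span_eq_card hs, Fintype.card_fin]
      · rfl
  have h := Nat.card_congr (Equiv.ofBijective f hf)
  rw [Nat.card_sigma, card_linearIndependent hk] at h
  have hW (W : {W : Submodule K V // finrank K W = k}) :
      Nat.card {s : Fin k → W.1 // LinearIndependent K s} =
        ∏ i : Fin k, (Nat.card K ^ k - Nat.card K ^ i.val) := by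
    rw [card_linearIndependent W.2.ge, W.2, Nat.card_eq_fintype_card]
  simp_rw [hW] at h
  simpa [Nat.card_eq_fintype_card] using h

theorem card_submodule_of_finrank_eq_four {K V : Type*} [Field K] [Finite K] [AddCommGroup V]
    [Module K V] [Finite V] (hV : finrank K V = 4) :
    (Nat.card (Submodule K V) : ℝ) =
      Nat.card K ^ 4 + 3 * Nat.card K ^ 3 + 4 * Nat.card K ^ 2 + 3 * Nat.card K + 5 := by
  have hsum : Nat.card (Submodule K V) =
      ∑ k : Fin 5, Nat.card {W : Submodule K V // finrank K W = k} := by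
    let d : Submodule K V → Fin 5 := fun W ↦ ⟨finrank K W, by
      have := Submodule.finrank_le W
      omega⟩
    rw [← Nat.card_congr (Equiv.sigmaFiberEquiv d), Nat.card_sigma]
    simp [d, Fin.ext_iff]
  have hq : 1 < Nat.card K := Finite.one_lt_card
  have key (k : ℕ) (hk : k ≤ 4) :
      (Nat.card {W : Submodule K V // finrank K W = k} : ℝ) *
        ∏ i : Fin k, ((Nat.card K : ℝ) ^ k - (Nat.card K : ℝ) ^ i.val) =
      ∏ i : Fin k, ((Nat.card K : ℝ) ^ 4 - (Nat.card K : ℝ) ^ i.val) := by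
    have h := card_submodule_finrank_mul (K := K) (V := V) (k := k) (by omega)
    rw [hV] at h
    have h' := congrArg (Nat.cast : ℕ → ℝ) h
    push_cast at h'
    convert h' using 2
    · refine Finset.prod_congr rfl fun i _ ↦ ?_
      rw [Nat.cast_sub (Nat.pow_le_pow_right hq.le i.2.le)]
      push_cast
      rfl
    · rename_i i _
      rw [Nat.cast_sub (Nat.pow_le_pow_right hq.le (i.2.le.trans hk))]
      push_cast
      rfl
  have hq' : (1 : ℝ) < Nat.card K := by exact_mod_cast hq
  rw [hsum, Fin.sum_univ_five]
  push_cast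
  generalize (Nat.card K : ℝ) = q at *
  have card_eq (k : ℕ) (hk : k ≤ 4) (c : ℝ)
      (hc : ∏ i : Fin k, (q ^ 4 - q ^ i.val) = c * ∏ i : Fin k, (q ^ k - q ^ i.val)) :
      (Nat.card {W : Submodule K V // finrank K W = k} : ℝ) = c := by
    refine mul_right_cancel₀ (Finset.prod_ne_zero_iff.2 fun i _ ↦ ?_) ((key k hk).trans hc)
    exact sub_ne_zero.2 (pow_lt_pow_right₀ hq' i.2).ne'
  have h0 := card_eq 0 (by norm_num) 1 (by simp)
  have h1 := card_eq 1 (by norm_num) (q ^ 3 + q ^ 2 + q + 1) (by simp; ring)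
  have h2 := card_eq 2 (by norm_num) ((q ^ 2 + 1) * (q ^ 2 + q + 1))
    (by simp [Fin.prod_univ_succ]; ring)
  have h3 := card_eq 3 (by norm_num) (q ^ 3 + q ^ 2 + q + 1) (by simp [Fin.prod_univ_succ]; ring)
  have h4 := card_eq 4 (by norm_num) 1 (by simp)
  simp only [Fin.coe_ofNat_eq_mod, Nat.reduceMod, h0, h1, h2, h3, h4]
  ring

theorem Subgroup.eq_prod_map_of_coprime {G H : Type*} [Group G] [Group H]
    (h : (Nat.card G).Coprime (Nat.card H)) (K : Subgroup (G × H)) :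
    K = (K.map (MonoidHom.fst G H)).prod (K.map (MonoidHom.snd G H)) := by
  apply le_antisymm
  · intro x hx
    exact ⟨⟨x, hx, rfl⟩, ⟨x, hx, rfl⟩⟩
  · rintro ⟨_, _⟩ ⟨⟨⟨g, b⟩, hx, rfl⟩, ⟨⟨a, h'⟩, hy, rfl⟩⟩
    obtain ⟨m, hm1, hm0⟩ := Nat.chineseRemainder h 1 0
    obtain ⟨n, hn0, hn1⟩ := Nat.chineseRemainder h 0 1
    have hg : g ^ m = g := by
      simpa using pow_eq_pow_iff_modEq.2 (hm1.of_dvd (_root_.orderOf_dvd_natCard g))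
    have ha : a ^ n = 1 := by
      simpa using pow_eq_pow_iff_modEq.2 (hn0.of_dvd (_root_.orderOf_dvd_natCard a))
    have hb : b ^ m = 1 := by
      simpa using pow_eq_pow_iff_modEq.2 (hm0.of_dvd (_root_.orderOf_dvd_natCard b))
    have hh : h' ^ n = h' := by
      simpa using pow_eq_pow_iff_modEq.2 (hn1.of_dvd (_root_.orderOf_dvd_natCard h'))
    have := K.mul_mem (K.pow_mem hx m) (K.pow_mem hy n)
    simpa [hg, ha, hb, hh] using this

theorem Subgroup.card_prod_of_coprime {G H : Type*} [Group G] [Group H]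
    (h : (Nat.card G).Coprime (Nat.card H)) :
    Nat.card (Subgroup (G × H)) = Nat.card (Subgroup G) * Nat.card (Subgroup H) := by
  rw [← Nat.card_prod]
  refine Nat.card_congr
    { toFun := fun K ↦ (K.map (MonoidHom.fst G H), K.map (MonoidHom.snd G H))
      invFun := fun P ↦ P.1.prod P.2
      left_inv := fun K ↦ (Subgroup.eq_prod_map_of_coprime h K).symm
      right_inv := ?_ }
  rintro ⟨A, B⟩
  ext x
  · simp only [Subgroup.mem_map, Subgroup.mem_prod]
    exact ⟨fun ⟨y, hy, e⟩ ↦ e ▸ hy.1, fun hx ↦ ⟨(x, 1), ⟨hx, B.one_mem⟩, rfl⟩⟩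
  · simp only [Subgroup.mem_map, Subgroup.mem_prod]
    exact ⟨fun ⟨y, hy, e⟩ ↦ e ▸ hy.2, fun hx ↦ ⟨(1, x), ⟨A.one_mem, hx⟩, rfl⟩⟩

theorem beta_prod_of_coprime {G H : Type*} [Group G] [Group H]
    (h : (Nat.card G).Coprime (Nat.card H)) : beta (G × H) = beta G * beta H := by
  simp only [beta, Subgroup.card_prod_of_coprime h, Nat.card_prod]
  push_cast
  exact mul_div_mul_comm _ _ _ _

theorem card_subgroup_multiplicative (p : ℕ) (V : Type*) [AddCommGroup V] [Module (ZMod p) V] :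
    Nat.card (Subgroup (Multiplicative V)) = Nat.card (Submodule (ZMod p) V) :=
  Nat.card_congr
    ((AddSubgroup.toSubgroup (A := V)).symm.trans (AddSubgroup.toZModSubmodule p)).toEquiv

theorem beta_multiplicative_zmod (p : ℕ) [Fact p.Prime] :
    beta (Multiplicative (ZMod p)) = 2 / p := by
  classical
  have h : Nat.card (Submodule (ZMod p) (ZMod p)) = 2 := by
    rw [Nat.card_congr (IsSimpleOrder.equivBool (α := Ideal (ZMod p)))]
    simp
  have hc : Nat.card (Multiplicative (ZMod p)) = p := Nat.card_zmod p
  rw [beta, card_subgroup_multiplicative p, h, hc]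
  norm_num

/-- The excess over `1` of `beta` for the elementary abelian group of order `p ^ 4`, for `p` prime;
extended by `0` to all natural numbers. -/
noncomputable def betaExcess (p : ℕ) : ℝ :=
  {p : ℕ | p.Prime}.indicator
    (fun p : ℕ ↦ (3 : ℝ) / p + 4 / (p : ℝ) ^ 2 + 3 / (p : ℝ) ^ 3 + 5 / (p : ℝ) ^ 4) p

theorem beta_multiplicative_fin_four_zmod (p : ℕ) [hp : Fact p.Prime] :
    beta (Multiplicative (Fin 4 → ZMod p)) = 1 + betaExcess p := by
  have hc : Nat.card (Multiplicative (Fin 4 → ZMod p)) = p ^ 4 := by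
    change Nat.card (Fin 4 → ZMod p) = p ^ 4
    simp
  have hp0 : (p : ℝ) ≠ 0 := by exact_mod_cast hp.out.ne_zero
  rw [beta, card_subgroup_multiplicative p, card_submodule_of_finrank_eq_four (by simp), hc,
    Nat.card_zmod, betaExcess, Set.indicator_of_mem (by exact hp.out)]
  push_cast
  field_simp
  ring

theorem one_div_le_betaExcess (n : ℕ) :
    {p : ℕ | p.Prime}.indicator (fun n : ℕ ↦ (1 : ℝ) / n) n ≤ betaExcess n := by
  refine Set.indicator_le_indicator ?_
  have h : (1 : ℝ) / n ≤ 3 / n := by gcongr; norm_num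
  have : (0 : ℝ) ≤ 4 / (n : ℝ) ^ 2 + 3 / (n : ℝ) ^ 3 + 5 / (n : ℝ) ^ 4 := by positivity
  linarith

theorem betaExcess_nonneg (n : ℕ) : 0 ≤ betaExcess n :=
  Set.indicator_nonneg (fun _ _ ↦ by positivity) _

theorem betaExcess_le (n : ℕ) : betaExcess n ≤ 15 / n := by
  refine Set.indicator_le' (g := fun n : ℕ ↦ (15 : ℝ) / n) (fun p hp ↦ ?_)
    (fun _ _ ↦ by positivity) n
  rw [Set.mem_ofPred_eq] at hp
  have hp1 : (1 : ℝ) ≤ p := by exact_mod_cast hp.one_lt.le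
  have h (k : ℕ) (hk : k ≠ 0) (c : ℝ) (hc : 0 ≤ c) : c / (p : ℝ) ^ k ≤ c / p := by
    gcongr
    exact le_self_pow₀ hp1 hk
  have h2 := h 2 (by norm_num) 4 (by norm_num)
  have h3 := h 3 (by norm_num) 3 (by norm_num)
  have h4 := h 4 (by norm_num) 5 (by norm_num)
  calc _ ≤ (3 : ℝ) / p + 4 / p + 3 / p + 5 / p := by linarith
    _ = 15 / p := by ring

theorem not_summable_betaExcess : ¬ Summable betaExcess := fun h ↦
  not_summable_one_div_on_primes <| h.of_nonneg_of_le
    (fun _ ↦ Set.indicator_nonneg (fun _ _ ↦ by positivity) _) one_div_le_betaExcess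

theorem one_add_sum_le_prod_one_add {ι : Type*} (s : Finset ι) {f : ι → ℝ}
    (hf : ∀ i, 0 ≤ f i) : 1 + ∑ i ∈ s, f i ≤ ∏ i ∈ s, (1 + f i) := by
  classical
  induction s using Finset.induction_on with
  | empty => simp
  | insert a s ha ih =>
    rw [Finset.sum_insert ha, Finset.prod_insert ha]
    have hs : 0 ≤ ∑ i ∈ s, f i := Finset.sum_nonneg fun i _ ↦ hf i
    nlinarith [hf a, mul_nonneg (hf a) hs, mul_le_mul_of_nonneg_left ih (hf a)]

theorem tendsto_prod_one_add_betaExcess (M : ℕ) :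
    Tendsto (fun k ↦ ∏ i ∈ Finset.range k, (1 + betaExcess (i + M))) atTop atTop := by
  have h : ¬ Summable fun i ↦ betaExcess (i + M) := by
    rw [summable_nat_add_iff]
    exact not_summable_betaExcess
  rw [not_summable_iff_tendsto_nat_atTop_of_nonneg fun _ ↦ betaExcess_nonneg _] at h
  refine tendsto_atTop_mono (fun k ↦ ?_) h
  have := one_add_sum_le_prod_one_add (Finset.range k) fun i ↦ betaExcess_nonneg (i + M)
  linarith

/-- Elementary abelian factors of order `p ^ 4` can be attached to a cyclic group of order `q`
for all primes `p` in an interval above `q`. -/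
theorem exists_beta_eq_mul_prod (q : ℕ) (hq : q.Prime) (k : ℕ) :
    ∃ (G : Type) (_ : Group G), Finite G ∧ (∀ r : ℕ, r.Prime → r ∣ Nat.card G → r < k + (q + 1)) ∧
      beta G = 2 / q * ∏ i ∈ Finset.range k, (1 + betaExcess (i + (q + 1))) := by
  induction k with
  | zero =>
    have := Fact.mk hq
    refine ⟨Multiplicative (ZMod q), inferInstance, inferInstance, fun r hr hd ↦ ?_, ?_⟩
    · have hd' : r ∣ q := by simpa using hd
      have := Nat.le_of_dvd hq.pos hd'
      omega
    · simp [beta_multiplicative_zmod]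
  | succ k ih =>
    obtain ⟨G, _, hfin, hG, hβ⟩ := ih
    rw [Finset.prod_range_succ, ← mul_assoc, ← hβ]
    by_cases hp : (k + (q + 1)).Prime
    · have := Fact.mk hp
      rw [add_right_comm k 1]
      generalize k + (q + 1) = p at *
      have hc : Nat.card (Multiplicative (Fin 4 → ZMod p)) = p ^ 4 := by
        change Nat.card (Fin 4 → ZMod p) = p ^ 4
        simp
      have hcop : (Nat.card G).Coprime (Nat.card (Multiplicative (Fin 4 → ZMod p))) := by
        rw [hc]
        refine Nat.Coprime.pow_right _ ((Nat.Prime.coprime_iff_not_dvd hp).2 fun h ↦ ?_).symm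
        exact (hG p hp h).false
      refine ⟨G × Multiplicative (Fin 4 → ZMod p), inferInstance, inferInstance,
        fun r hr hd ↦ ?_, ?_⟩
      · rw [Nat.card_prod, hc, hr.dvd_mul] at hd
        rcases hd with hd | hd
        · have := hG r hr hd
          omega
        · have := (Nat.prime_dvd_prime_iff_eq hr hp).1 (hr.dvd_of_dvd_pow hd)
          omega
      · rw [beta_prod_of_coprime hcop, beta_multiplicative_fin_four_zmod]
    · refine ⟨G, inferInstance, hfin, fun r hr hd ↦ ?_, ?_⟩
      · have := hG r hr hd
        omega
      · rw [betaExcess, Set.indicator_of_notMem (by exact hp)]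
        simp

theorem stmt_14 :
    closure {x : ℝ | ∃ (G : Type) (inst : Group G),
      Finite G ∧ @beta G inst = x} = Set.Ici (0 : ℝ) := by
  apply subset_antisymm
  · refine closure_minimal ?_ isClosed_Ici
    rintro _ ⟨G, _, _, rfl⟩
    rw [Set.mem_Ici, beta]
    positivity
  rw [← closure_Ioi]
  refine closure_minimal (fun x hx ↦ ?_) isClosed_closure
  rw [Set.mem_Ioi] at hx
  rw [Metric.mem_closure_iff]
  intro ε hε
  obtain ⟨q, hqle, hq⟩ := Nat.exists_infinite_primes (max ⌈2 / x⌉₊ (⌈15 * x / ε⌉₊))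
  have hq0 : (0 : ℝ) < q := by exact_mod_cast hq.pos
  have hqx : 2 / (q : ℝ) ≤ x := by
    have : 2 / x ≤ q := (Nat.le_ceil _).trans (by exact_mod_cast (le_max_left _ _).trans hqle)
    rw [div_le_iff₀ hx] at this
    rw [div_le_iff₀ hq0]
    linarith
  have hqε : 15 * x ≤ q * ε := by
    rw [← div_le_iff₀ hε]
    exact (Nat.le_ceil _).trans (by exact_mod_cast (le_max_right _ _).trans hqle)
  set P : ℕ → ℝ := fun k ↦ 2 / q * ∏ i ∈ Finset.range k, (1 + betaExcess (i + (q + 1))) with hP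
  have hex : ∃ k, x < P k :=
    (((tendsto_prod_one_add_betaExcess (q + 1)).const_mul_atTop
      (by positivity : (0 : ℝ) < 2 / q)).eventually_gt_atTop x).exists
  classical
  obtain ⟨k, hk⟩ : ∃ k, Nat.find hex = k + 1 := by
    refine Nat.exists_eq_succ_of_ne_zero fun h0 ↦ ?_
    have := Nat.find_spec hex
    rw [h0] at this
    simp only [hP, Finset.range_zero, Finset.prod_empty, mul_one] at this
    linarith
  have hlt : x < P (k + 1) := hk ▸ Nat.find_spec hex
  have hle : P k ≤ x := not_lt.1 (Nat.find_min hex (by omega))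
  obtain ⟨G, inst, hfin, -, hβ⟩ := exists_beta_eq_mul_prod q hq k
  refine ⟨P k, ⟨G, inst, hfin, hβ⟩, ?_⟩
  have hstep : P (k + 1) = P k + P k * betaExcess (k + (q + 1)) := by
    simp only [hP, Finset.prod_range_succ]
    ring
  have hsmall : x * betaExcess (k + (q + 1)) < ε := by
    have h1 : betaExcess (k + (q + 1)) < 15 / q := by
      refine (betaExcess_le _).trans_lt ?_
      gcongr
      omega
    calc x * betaExcess (k + (q + 1)) < x * (15 / q) := by gcongr
      _ = 15 * x / q := by ring
      _ ≤ ε := by rw [div_le_iff₀ hq0]; linarith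
  have hmul := mul_le_mul_of_nonneg_right hle (betaExcess_nonneg (k + (q + 1)))
  rw [Real.dist_eq, abs_of_nonneg (by linarith)]
  linarith
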